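/- Let (μ_t)_{t∈[0,T]} be a subprobability solution to (NLFPK). Then Γ_t := δ_{μ_t} (the Dirac measure on SP at μ_t) defines a weakly continuous solution (Γ_t)_{t∈[0,T]} to the linearized continuity equation (SP-CE). -/

import Mathlib

open MeasureTheory Topology Filter

noncomputable section

/-- Euclidean space `ℝ^d`. -/
abbrev Rd (d : ℕ) := Fin d → ℝ

/-- The space of subprobability measures on `ℝ^d`. -/
def SP (d : ℕ) : Type := {μ : Measure (Rd d) // μ Set.univ ≤ 1}

/-- The vague topology on `SP d`: the initial topology of the maps `μ ↦ ∫ g dμ` for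
`g : ℝ^d → ℝ` continuous with compact support. -/
instance (d : ℕ) : TopologicalSpace (SP d) :=
  ⨅ g : {g : Rd d → ℝ // Continuous g ∧ HasCompactSupport g},
    TopologicalSpace.induced (fun μ : SP d => ∫ x, g.1 x ∂μ.1) inferInstance

instance (d : ℕ) : MeasurableSpace (SP d) := borel (SP d)
instance (d : ℕ) : BorelSpace (SP d) := ⟨rfl⟩

/-- First-order partial derivative `∂_i f`. -/
def pd {n : ℕ} (f : (Fin n → ℝ) → ℝ) (i : Fin n) (x : Fin n → ℝ) : ℝ :=
  fderiv ℝ f x (Pi.single i 1)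

/-- Second-order partial derivative `∂²_{ij} f`. -/
def pd2 {n : ℕ} (f : (Fin n → ℝ) → ℝ) (i j : Fin n) (x : Fin n → ℝ) : ℝ :=
  fderiv ℝ (fun y => pd f j y) x (Pi.single i 1)

/-- Twice continuously differentiable with compact support. -/
def IsC2c {n : ℕ} (φ : (Fin n → ℝ) → ℝ) : Prop :=
  ContDiff ℝ 2 φ ∧ HasCompactSupport φ

/-- Twice continuously differentiable, bounded, with bounded first and second order
partial derivatives. -/
def IsC2b {n : ℕ} (f : (Fin n → ℝ) → ℝ) : Prop :=
  ContDiff ℝ 2 f ∧ ∃ M : ℝ, ∀ x, |f x| ≤ M ∧ (∀ i, |pd f i x| ≤ M) ∧ ∀ i j, |pd2 f i j x| ≤ M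

/-- Borel coefficients, with `a` symmetric and positive semidefinite (`S⁺_d`-valued). -/
def GoodCoeffs (d : ℕ) (a : ℝ → SP d → Rd d → Fin d → Fin d → ℝ)
    (b : ℝ → SP d → Rd d → Fin d → ℝ) : Prop :=
  (∀ i j, Measurable fun p : ℝ × SP d × Rd d => a p.1 p.2.1 p.2.2 i j) ∧
  (∀ i, Measurable fun p : ℝ × SP d × Rd d => b p.1 p.2.1 p.2.2 i) ∧
  (∀ t μ x i j, a t μ x i j = a t μ x j i) ∧
  (∀ t μ x (v : Fin d → ℝ), 0 ≤ ∑ i, ∑ j, v i * a t μ x i j * v j)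

/-- The Kolmogorov operator `L_{t,μ}φ = ∑ a_ij ∂²_ij φ + ∑ b_i ∂_i φ`. -/
def Lop {d : ℕ} (a : ℝ → SP d → Rd d → Fin d → Fin d → ℝ)
    (b : ℝ → SP d → Rd d → Fin d → ℝ) (t : ℝ) (μ : SP d) (φ : Rd d → ℝ) (x : Rd d) : ℝ :=
  (∑ i, ∑ j, a t μ x i j * pd2 φ i j x) + ∑ i, b t μ x i * pd φ i x

/-- Global integrability condition for (NLFPK). -/
def NLFPKIntegrable (d : ℕ) (T : ℝ) (a : ℝ → SP d → Rd d → Fin d → Fin d → ℝ)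
    (b : ℝ → SP d → Rd d → Fin d → ℝ) (μ : ℝ → SP d) : Prop :=
  ∀ i j, ∫⁻ t in Set.Ioc (0:ℝ) T,
      ∫⁻ x, ENNReal.ofReal (|a t (μ t) x i j| + |b t (μ t) x i|) ∂(μ t).1 < ⊤

/-- The weak form of the nonlinear FPK equation, tested against `φ` at time `t`. -/
def NLFPKEq (d : ℕ) (a : ℝ → SP d → Rd d → Fin d → Fin d → ℝ)
    (b : ℝ → SP d → Rd d → Fin d → ℝ) (μ : ℝ → SP d) (φ : Rd d → ℝ) (t : ℝ) : Prop :=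
  ∫ x, φ x ∂(μ t).1 - ∫ x, φ x ∂(μ 0).1 = ∫ s in (0:ℝ)..t, ∫ x, Lop a b s (μ s) φ x ∂(μ s).1

/-- Subprobability solution to (NLFPK): a vaguely continuous, globally integrable curve
in `SP` satisfying the weak equation for all test functions in `C²_c(ℝ^d)`. -/
def IsSubprobSolution (d : ℕ) (T : ℝ) (a : ℝ → SP d → Rd d → Fin d → Fin d → ℝ)
    (b : ℝ → SP d → Rd d → Fin d → ℝ) (μ : ℝ → SP d) : Prop :=
  ContinuousOn μ (Set.Icc 0 T) ∧ NLFPKIntegrable d T a b μ ∧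
  ∀ φ : Rd d → ℝ, IsC2c φ → ∀ t ∈ Set.Icc (0:ℝ) T, NLFPKEq d a b μ φ t

/-- Weak continuity (in duality with bounded continuous functions) of a curve in `SP`. -/
def WeaklyContinuousOn {d : ℕ} (μ : ℝ → SP d) (s : Set ℝ) : Prop :=
  ∀ f : Rd d → ℝ, Continuous f → (∃ M, ∀ x, |f x| ≤ M) →
    ContinuousOn (fun t => ∫ x, f x ∂(μ t).1) s

/-- Probability solution to (NLFPK): a weakly continuous solution consisting of
probability measures. -/
def IsProbSolution (d : ℕ) (T : ℝ) (a : ℝ → SP d → Rd d → Fin d → Fin d → ℝ)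
    (b : ℝ → SP d → Rd d → Fin d → ℝ) (μ : ℝ → SP d) : Prop :=
  IsSubprobSolution d T a b μ ∧ (∀ t ∈ Set.Icc (0:ℝ) T, (μ t).1 Set.univ = 1) ∧
  WeaklyContinuousOn μ (Set.Icc 0 T)

/-- `φ` and `ψ` are uniformly `ε`-close, together with their first and second order
partial derivatives (closeness in the `C²_b` norm). -/
def C2Close {n : ℕ} (φ ψ : (Fin n → ℝ) → ℝ) (ε : ℝ) : Prop :=
  (∀ x, |φ x - ψ x| ≤ ε) ∧ (∀ i x, |pd φ i x - pd ψ i x| ≤ ε) ∧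
  ∀ i j x, |pd2 φ i j x - pd2 ψ i j x| ≤ ε

/-- A countable family `g i ∈ C²_c(ℝ^d) \ {0}` which is dense in `C²_c(ℝ^d)` with respect
to the `C²_b` norm. -/
def GFamily (d : ℕ) (g : ℕ → Rd d → ℝ) : Prop :=
  (∀ i, IsC2c (g i)) ∧ (∀ i, g i ≠ 0) ∧
  ∀ φ : Rd d → ℝ, IsC2c φ → ∀ ε : ℝ, 0 < ε → ∃ i, C2Close (g i) φ ε

/-- The global chart `G : SP → ℝ^∞`, `G(μ) = (μ(g_i))_i`. -/
def Gmap {d : ℕ} (g : ℕ → Rd d → ℝ) (μ : SP d) : ℕ → ℝ := fun i => ∫ x, g i x ∂μ.1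

/-- `F(μ) = f(μ(g_1),…,μ(g_n))`, a typical element of `FC²_b(G)`. -/
def Fof {d : ℕ} (g : ℕ → Rd d → ℝ) {n : ℕ} (f : (Fin n → ℝ) → ℝ) (μ : SP d) : ℝ :=
  f fun k : Fin n => ∫ x, g k x ∂μ.1

/-- The action `𝐋_t F(μ) = ⟨∇^{SP} F(μ), b(t,μ) + a(t,μ)∇⟩_{L²(μ)}` of the linearized
operator on `F(μ) = f(μ(g_1),…,μ(g_n)) ∈ FC²_b(G)`. -/
def bL {d : ℕ} (a : ℝ → SP d → Rd d → Fin d → Fin d → ℝ)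
    (b : ℝ → SP d → Rd d → Fin d → ℝ) (g : ℕ → Rd d → ℝ) {n : ℕ}
    (f : (Fin n → ℝ) → ℝ) (t : ℝ) (μ : SP d) : ℝ :=
  ∑ k : Fin n, pd f k (fun l : Fin n => ∫ x, g l x ∂μ.1) * ∫ x, Lop a b t μ (g k) x ∂μ.1

/-- Weak continuity of a curve of Borel measures on `SP`. -/
def WeaklyContinuousMeasOn {d : ℕ} (Γ : ℝ → Measure (SP d)) (s : Set ℝ) : Prop :=
  ∀ F : SP d → ℝ, Continuous F → (∃ M, ∀ μ, |F μ| ≤ M) →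
    ContinuousOn (fun t => ∫ μ, F μ ∂(Γ t)) s

/-- Weakly continuous solution to the linearized continuity equation (SP-CE) on `P(SP)`. -/
def IsSPCESolution (d : ℕ) (T : ℝ) (a : ℝ → SP d → Rd d → Fin d → Fin d → ℝ)
    (b : ℝ → SP d → Rd d → Fin d → ℝ) (g : ℕ → Rd d → ℝ)
    (Γ : ℝ → Measure (SP d)) : Prop :=
  (∀ t ∈ Set.Icc (0:ℝ) T, IsProbabilityMeasure (Γ t)) ∧
  WeaklyContinuousMeasOn Γ (Set.Icc 0 T) ∧
  (∫⁻ t in Set.Ioc (0:ℝ) T, ∫⁻ μ : SP d,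
      (∫⁻ x, ENNReal.ofReal ((∑ i, |b t μ x i|) + ∑ i, ∑ j, |a t μ x i j|) ∂μ.1) ∂(Γ t) < ⊤) ∧
  ∀ (n : ℕ) (f : (Fin n → ℝ) → ℝ), IsC2b f → ∀ t ∈ Set.Icc (0:ℝ) T,
    ∫ μ, Fof g f μ ∂(Γ t) - ∫ μ, Fof g f μ ∂(Γ 0) =
      ∫ s in (0:ℝ)..t, ∫ μ, bL a b g f s μ ∂(Γ s)

namespace SP

variable {d : ℕ}

instance (μ : SP d) : IsFiniteMeasure μ.1 := ⟨μ.2.trans_lt ENNReal.one_lt_top⟩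

theorem continuous_integral {φ : Rd d → ℝ} (hφ : Continuous φ) (hs : HasCompactSupport φ) :
    Continuous fun μ : SP d => ∫ x, φ x ∂μ.1 :=
  continuous_iInf_dom (i := (⟨φ, hφ, hs⟩ : {φ : Rd d → ℝ // Continuous φ ∧ HasCompactSupport φ}))
    continuous_induced_dom

instance : T2Space (SP d) := by
  refine T2Space.of_injective_continuous
    (f := fun (μ : SP d) (φ : CompactlySupportedContinuousMap (Rd d) ℝ) => ∫ x, φ x ∂μ.1)
    (fun μ ν h => Subtype.ext ?_) ?_
  · exact Measure.ext_of_integral_eq_on_compactlySupported fun φ => congrFun h φ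
  · exact continuous_pi fun φ => continuous_integral φ.continuous φ.hasCompactSupport

theorem measurable_measure_of_isCompact {K : Set (Rd d)} (hK : IsCompact K) :
    Measurable fun μ : SP d => μ.1 K := by
  have hpos : ∀ n : ℕ, (0 : ℝ) < 1 / ((n : ℝ) + 1) := fun n => Nat.one_div_pos_of_nat
  have hsupp : ∀ n, HasCompactSupport fun x => (thickenedIndicator (hpos n) K x : ℝ) := fun n =>
    HasCompactSupport.intro (hK.cthickening (r := 1 / ((n : ℝ) + 1))) fun x hx => by
      rw [thickenedIndicator_zero (hpos n) K
        fun h => hx (Metric.thickening_subset_cthickening _ _ h), NNReal.coe_zero]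
  have hmeas : ∀ n, Measurable fun μ : SP d =>
      ∫⁻ x, (thickenedIndicator (hpos n) K x : ENNReal) ∂μ.1 := fun n => by
    have hc := (continuous_integral
      (NNReal.continuous_coe.comp (thickenedIndicator (hpos n) K).continuous) (hsupp n)).measurable
    convert! hc.ennreal_ofReal using 2 with μ
    exact lintegral_coe_eq_integral _ (integrable_thickenedIndicator K (hpos n))
  exact measurable_of_tendsto_metrizable hmeas <| tendsto_pi_nhds.2 fun μ =>
    tendsto_lintegral_thickenedIndicator_of_isClosed μ.1 hK.isClosed hpos
      tendsto_one_div_add_atTop_nhds_zero_nat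

theorem measurable_measure_of_isClosed {F : Set (Rd d)} (hF : IsClosed F) :
    Measurable fun μ : SP d => μ.1 F := by
  have hmono : Monotone fun n : ℕ => F ∩ Metric.closedBall 0 (n : ℝ) := fun m n hmn =>
    Set.inter_subset_inter_right _ (Metric.closedBall_subset_closedBall (by exact_mod_cast hmn))
  have hunion : ⋃ n : ℕ, F ∩ Metric.closedBall 0 (n : ℝ) = F := by
    rw [← Set.inter_iUnion, Metric.iUnion_closedBall_nat, Set.inter_univ]
  have heq : (fun μ : SP d => μ.1 F) =
      fun μ : SP d => ⨆ n : ℕ, μ.1 (F ∩ Metric.closedBall 0 (n : ℝ)) := by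
    funext μ
    rw [← hmono.measure_iUnion, hunion]
  rw [heq]
  exact Measurable.iSup fun n =>
    measurable_measure_of_isCompact ((isCompact_closedBall 0 (n : ℝ)).inter_left hF)

/-- The Borel σ-algebra of the vague topology makes every evaluation `μ ↦ μ A` measurable. -/
theorem measurable_measure : Measurable fun μ : SP d => μ.1 :=
  Measurable.measure_of_isPiSystem
    (BorelSpace.measurable_eq.trans borel_eq_generateFrom_isClosed) isPiSystem_isClosed
    (fun _ hF => measurable_measure_of_isClosed hF) (measurable_measure_of_isClosed isClosed_univ)

/-- The kernel `(t, μ) ↦ μ`. -/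
def timeKernel (d : ℕ) : ProbabilityTheory.Kernel (ℝ × SP d) (Rd d) :=
  ⟨fun p => p.2.1, measurable_measure.comp measurable_snd⟩

instance : ProbabilityTheory.IsFiniteKernel (timeKernel d) :=
  ⟨⟨1, ENNReal.one_lt_top, fun p => p.2.2⟩⟩

theorem aemeasurable_lintegral {ν : Measure ℝ} {μ : ℝ → SP d} (hμ : AEMeasurable μ ν)
    {F : ℝ × SP d × Rd d → ENNReal} (hF : Measurable F) :
    AEMeasurable (fun t => ∫⁻ x, F (t, μ t, x) ∂(μ t).1) ν := by
  have h : Measurable fun p : ℝ × SP d => ∫⁻ x, F (p.1, p.2, x) ∂timeKernel d p :=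
    Measurable.lintegral_kernel_prod_right' (f := fun q : (ℝ × SP d) × Rd d => F (q.1.1, q.1.2, q.2))
      (by fun_prop)
  exact h.comp_aemeasurable (aemeasurable_id.prodMk hμ)

theorem aestronglyMeasurable_integral {ν : Measure ℝ} {μ : ℝ → SP d} (hμ : AEMeasurable μ ν)
    {F : ℝ × SP d × Rd d → ℝ} (hF : Measurable F) :
    AEStronglyMeasurable (fun t => ∫ x, F (t, μ t, x) ∂(μ t).1) ν := by
  have h : StronglyMeasurable fun p : ℝ × SP d => ∫ x, F (p.1, p.2, x) ∂timeKernel d p :=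
    StronglyMeasurable.integral_kernel_prod_right'
      (f := fun q : (ℝ × SP d) × Rd d => F (q.1.1, q.1.2, q.2))
      (Measurable.stronglyMeasurable (by fun_prop))
  exact (h.measurable.comp_aemeasurable (aemeasurable_id.prodMk hμ)).aestronglyMeasurable

end SP

theorem LipschitzOnWith.comp_absolutelyContinuousOnInterval {X Y : Type*} [PseudoMetricSpace X]
    [PseudoMetricSpace Y] {K : NNReal} {f : X → Y} {s : Set X} {u : ℝ → X} {a b : ℝ}
    (hf : LipschitzOnWith K f s) (hu : AbsolutelyContinuousOnInterval u a b)
    (hs : Set.MapsTo u (Set.uIcc a b) s) : AbsolutelyContinuousOnInterval (f ∘ u) a b := by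
  rw [absolutelyContinuousOnInterval_iff] at hu ⊢
  intro ε hε
  obtain ⟨δ, hδ, h⟩ := hu (ε / (K + 1)) (by positivity)
  refine ⟨δ, hδ, fun I hI hlen => ?_⟩
  calc ∑ i ∈ Finset.range I.1, dist ((f ∘ u) (I.2 i).1) ((f ∘ u) (I.2 i).2)
      ≤ ∑ i ∈ Finset.range I.1, ((K : ℝ) + 1) * dist (u (I.2 i).1) (u (I.2 i).2) := by
        refine Finset.sum_le_sum fun i hi => ?_
        refine (hf.dist_le_mul _ (hs (hI.1 i hi).1) _ (hs (hI.1 i hi).2)).trans ?_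
        gcongr
        linarith
    _ = (K + 1) * ∑ i ∈ Finset.range I.1, dist (u (I.2 i).1) (u (I.2 i).2) := by
        rw [Finset.mul_sum]
    _ < (K + 1) * (ε / (K + 1)) := by
        gcongr
        exact h I hI hlen
    _ = ε := by field_simp

theorem AbsolutelyContinuousOnInterval.congr {X : Type*} [PseudoMetricSpace X] {u v : ℝ → X}
    {a b : ℝ} (hu : AbsolutelyContinuousOnInterval u a b) (huv : Set.EqOn u v (Set.uIcc a b)) :
    AbsolutelyContinuousOnInterval v a b := by
  refine Tendsto.congr' ?_ hu
  rw [EventuallyEq, eventually_inf_principal]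
  refine Eventually.of_forall fun I hI => Finset.sum_congr rfl fun i hi => ?_
  rw [huv (hI.1 i hi).1, huv (hI.1 i hi).2]

theorem AbsolutelyContinuousOnInterval.pi {ι : Type*} [Fintype ι] {X : ι → Type*}
    [∀ k, PseudoMetricSpace (X k)] {u : ℝ → ∀ k, X k} {a b : ℝ}
    (hu : ∀ k, AbsolutelyContinuousOnInterval (fun t => u t k) a b) :
    AbsolutelyContinuousOnInterval u a b := by
  refine squeeze_zero (fun I => Finset.sum_nonneg fun i _ => dist_nonneg) (fun I => ?_)
    (by simpa using tendsto_finsetSum Finset.univ fun k _ => hu k)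
  rw [Finset.sum_comm]
  refine Finset.sum_le_sum fun i _ => ?_
  exact (dist_pi_le_iff (Finset.sum_nonneg fun k _ => dist_nonneg)).2 fun k =>
    Finset.single_le_sum (f := fun k => dist (u (I.2 i).1 k) (u (I.2 i).2 k))
      (fun k _ => dist_nonneg) (Finset.mem_univ k)

theorem intervalIntegral_apply {ι : Type*} [Fintype ι] {h : ℝ → ι → ℝ} {a b : ℝ}
    (hh : IntervalIntegrable h volume a b) (k : ι) :
    (∫ s in a..b, h s) k = ∫ s in a..b, h s k :=
  ((ContinuousLinearMap.proj (R := ℝ) (φ := fun _ : ι => ℝ) k).intervalIntegral_comp_comm hh).symm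

/-- Chain rule for a `C¹` function along an absolutely continuous curve. -/
theorem ContDiff.integral_fderiv_comp_primitive {ι : Type*} [Fintype ι] {f : (ι → ℝ) → ℝ}
    (hf : ContDiff ℝ 1 f) {h : ℝ → ι → ℝ} {a b : ℝ} (hh : IntervalIntegrable h volume a b)
    (c : ι → ℝ) :
    f (c + ∫ s in a..b, h s) - f c =
      ∫ t in a..b, fderiv ℝ f (c + ∫ s in a..t, h s) (h t) := by
  set u : ℝ → ι → ℝ := fun t => c + ∫ s in a..t, h s with hu
  have hhk : ∀ k, IntervalIntegrable (fun s => h s k) volume a b := fun k =>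
    ⟨hh.1.eval k, hh.2.eval k⟩
  have hu_ac : AbsolutelyContinuousOnInterval u a b := by
    have hprim : AbsolutelyContinuousOnInterval (fun t k => c k + ∫ s in a..t, h s k) a b :=
      AbsolutelyContinuousOnInterval.pi fun k =>
        (LipschitzWith.const (c k)).lipschitzOnWith.absolutelyContinuousOnInterval.fun_add
          ((hhk k).absolutelyContinuousOnInterval_intervalIntegral Set.left_mem_uIcc)
    refine hprim.congr fun t ht => funext fun k => ?_
    simp only [hu, Pi.add_apply]
    rw [intervalIntegral_apply (hh.mono_set (Set.uIcc_subset_uIcc_left ht))]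
  obtain ⟨R, hR⟩ := hu_ac.exists_bound
  obtain ⟨K, hK⟩ := hf.contDiffOn.exists_lipschitzOnWith one_ne_zero
    (convex_closedBall (0 : ι → ℝ) R) (isCompact_closedBall 0 R)
  have hfu : AbsolutelyContinuousOnInterval (f ∘ u) a b :=
    hK.comp_absolutelyContinuousOnInterval hu_ac fun t ht => mem_closedBall_zero_iff.2 (hR t ht)
  have hua : u a = c := by simp [hu]
  have hftc := hfu.integral_deriv_eq_sub
  simp only [Function.comp_apply, hua] at hftc
  rw [← hftc]
  refine intervalIntegral.integral_congr_ae ?_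
  filter_upwards [hh.ae_hasDerivAt_integral] with t ht htab
  have hut : HasDerivAt u (h t) t :=
    (ht (Set.uIoc_subset_uIcc htab) a Set.left_mem_uIcc).const_add c
  exact ((hf.differentiable one_ne_zero (u t)).hasFDerivAt.comp_hasDerivAt t hut).deriv

theorem fderiv_apply_eq_sum_pd {n : ℕ} (f : (Fin n → ℝ) → ℝ) (x v : Fin n → ℝ) :
    fderiv ℝ f x v = ∑ k, pd f k x * v k := by
  conv_lhs => rw [pi_eq_sum_univ' v, map_sum]
  refine Finset.sum_congr rfl fun k _ => ?_
  rw [map_smul, smul_eq_mul, mul_comm, pd]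

theorem measurable_pd {n : ℕ} (f : (Fin n → ℝ) → ℝ) (i : Fin n) : Measurable (pd f i) :=
  measurable_fderiv_apply_const ℝ f _

theorem measurable_pd2 {n : ℕ} (f : (Fin n → ℝ) → ℝ) (i j : Fin n) : Measurable (pd2 f i j) :=
  measurable_fderiv_apply_const ℝ _ _

theorem IsC2c.exists_bound {n : ℕ} {φ : (Fin n → ℝ) → ℝ} (hφ : IsC2c φ) :
    ∃ C : ℝ, 0 ≤ C ∧ (∀ i x, |pd φ i x| ≤ C) ∧ ∀ i j x, |pd2 φ i j x| ≤ C := by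
  have hpd : ∀ i, ContDiff ℝ 1 (pd φ i) := fun i =>
    (hφ.1.fderiv_right (m := 1) (by norm_num)).clm_apply contDiff_const
  have hpds : ∀ i, HasCompactSupport (pd φ i) := fun i => hφ.2.fderiv_apply (𝕜 := ℝ) _
  have hpd2 : ∀ i j, Continuous (pd2 φ i j) := fun i j =>
    ((hpd j).continuous_fderiv one_ne_zero).clm_apply continuous_const
  have hpd2s : ∀ i j, HasCompactSupport (pd2 φ i j) := fun i j => (hpds j).fderiv_apply (𝕜 := ℝ) _
  choose A hA using fun i => (hpds i).exists_bound_of_continuous (hpd i).continuous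
  choose B hB using fun i j => (hpd2s i j).exists_bound_of_continuous (hpd2 i j)
  have hA0 : ∀ i, 0 ≤ A i := fun i => (norm_nonneg _).trans (hA i 0)
  have hB0 : ∀ i j, 0 ≤ B i j := fun i j => (norm_nonneg _).trans (hB i j 0)
  have hBs : ∀ i, 0 ≤ ∑ j, B i j := fun i => Finset.sum_nonneg fun j _ => hB0 i j
  refine ⟨(∑ i, A i) + ∑ i, ∑ j, B i j, add_nonneg (Finset.sum_nonneg fun i _ => hA0 i)
    (Finset.sum_nonneg fun i _ => hBs i), fun i x => ?_, fun i j x => ?_⟩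
  · exact ((hA i x).trans (Finset.single_le_sum (fun k _ => hA0 k) (Finset.mem_univ i))).trans
      (le_add_of_nonneg_right (Finset.sum_nonneg fun i _ => hBs i))
  · exact (((hB i j x).trans
      (Finset.single_le_sum (fun k _ => hB0 i k) (Finset.mem_univ j))).trans
      (Finset.single_le_sum (fun k _ => hBs k) (Finset.mem_univ i))).trans
      (le_add_of_nonneg_left (Finset.sum_nonneg fun i _ => hA0 i))

section Coefficients

variable {d : ℕ} {a : ℝ → SP d → Rd d → Fin d → Fin d → ℝ} {b : ℝ → SP d → Rd d → Fin d → ℝ}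

theorem GoodCoeffs.measurable_Lop (hab : GoodCoeffs d a b) (φ : Rd d → ℝ) :
    Measurable fun p : ℝ × SP d × Rd d => Lop a b p.1 p.2.1 φ p.2.2 := by
  have hx : Measurable fun p : ℝ × SP d × Rd d => p.2.2 := by fun_prop
  refine Measurable.add (Finset.measurable_fun_sum _ fun i _ => Finset.measurable_fun_sum _
    fun j _ => ?_) (Finset.measurable_fun_sum _ fun i _ => ?_)
  · exact (hab.1 i j).mul ((measurable_pd2 φ i j).comp hx)
  · exact (hab.2.1 i).mul ((measurable_pd φ i).comp hx)

theorem abs_Lop_le {φ : Rd d → ℝ} {C : ℝ} (h₁ : ∀ i x, |pd φ i x| ≤ C)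
    (h₂ : ∀ i j x, |pd2 φ i j x| ≤ C) (t : ℝ) (μ : SP d) (x : Rd d) :
    |Lop a b t μ φ x| ≤ C * ((∑ i, |b t μ x i|) + ∑ i, ∑ j, |a t μ x i j|) := by
  rw [mul_add, add_comm, Finset.mul_sum, Finset.mul_sum]
  refine (abs_add_le _ _).trans (add_le_add ?_ ?_)
  · refine (Finset.abs_sum_le_sum_abs _ _).trans (Finset.sum_le_sum fun i _ => ?_)
    rw [Finset.mul_sum]
    refine (Finset.abs_sum_le_sum_abs _ _).trans (Finset.sum_le_sum fun j _ => ?_)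
    rw [abs_mul, mul_comm]
    gcongr
    exact h₂ i j x
  · refine (Finset.abs_sum_le_sum_abs _ _).trans (Finset.sum_le_sum fun i _ => ?_)
    rw [abs_mul, mul_comm]
    gcongr
    exact h₁ i x

theorem NLFPKIntegrable.lintegral_sum_lt_top {T : ℝ} {μ : ℝ → SP d} (hab : GoodCoeffs d a b)
    (hcont : ContinuousOn μ (Set.Icc 0 T)) (hint : NLFPKIntegrable d T a b μ) :
    ∫⁻ t in Set.Ioc (0 : ℝ) T, ∫⁻ x, ENNReal.ofReal ((∑ i, |b t (μ t) x i|) +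
      ∑ i, ∑ j, |a t (μ t) x i j|) ∂(μ t).1 < ⊤ := by
  have hμ : AEMeasurable μ (volume.restrict (Set.Ioc 0 T)) :=
    (hcont.mono Set.Ioc_subset_Icc_self).aemeasurable measurableSet_Ioc
  have hm : ∀ i j, Measurable fun p : ℝ × SP d × Rd d =>
      ENNReal.ofReal (|a p.1 p.2.1 p.2.2 i j| + |b p.1 p.2.1 p.2.2 i|) := fun i j =>
    ((hab.1 i j).norm.add (hab.2.1 i).norm).ennreal_ofReal
  have hbound : ∀ t x, ENNReal.ofReal ((∑ i, |b t (μ t) x i|) + ∑ i, ∑ j, |a t (μ t) x i j|) ≤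
      ∑ i, ∑ j, ENNReal.ofReal (|a t (μ t) x i j| + |b t (μ t) x i|) := fun t x => by
    rw [← Finset.sum_congr rfl fun i _ => ENNReal.ofReal_sum_of_nonneg fun j _ =>
        add_nonneg (abs_nonneg (a t (μ t) x i j)) (abs_nonneg (b t (μ t) x i)),
      ← ENNReal.ofReal_sum_of_nonneg fun _ _ => by positivity, add_comm,
      ← Finset.sum_add_distrib]
    refine ENNReal.ofReal_le_ofReal (Finset.sum_le_sum fun i _ => ?_)
    rw [Finset.sum_add_distrib]
    gcongr
    exact Finset.single_le_sum (f := fun _ : Fin d => |b t (μ t) x i|) (fun _ _ => abs_nonneg _)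
      (Finset.mem_univ i)
  calc _ ≤ ∫⁻ t in Set.Ioc (0 : ℝ) T, ∫⁻ x, ∑ i, ∑ j,
        ENNReal.ofReal (|a t (μ t) x i j| + |b t (μ t) x i|) ∂(μ t).1 :=
        lintegral_mono fun t => lintegral_mono (hbound t)
    _ = ∫⁻ t in Set.Ioc (0 : ℝ) T, ∑ i, ∑ j, ∫⁻ x,
        ENNReal.ofReal (|a t (μ t) x i j| + |b t (μ t) x i|) ∂(μ t).1 := by
        refine lintegral_congr fun t => ?_
        have hm' : ∀ i j, Measurable fun x =>
            ENNReal.ofReal (|a t (μ t) x i j| + |b t (μ t) x i|) := fun i j =>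
          (hm i j).comp (g := fun p => _) (f := fun x => (t, μ t, x)) (by fun_prop)
        rw [lintegral_finsetSum _ fun i _ => Finset.measurable_fun_sum _ fun j _ => hm' i j]
        exact Finset.sum_congr rfl fun i _ => lintegral_finsetSum _ fun j _ => hm' i j
    _ = ∑ i, ∑ j, ∫⁻ t in Set.Ioc (0 : ℝ) T, ∫⁻ x,
        ENNReal.ofReal (|a t (μ t) x i j| + |b t (μ t) x i|) ∂(μ t).1 := by
        have hm' := fun i j => SP.aemeasurable_lintegral hμ (hm i j)
        rw [lintegral_finsetSum' _ fun i _ => Finset.aemeasurable_fun_sum _ fun j _ => hm' i j]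
        exact Finset.sum_congr rfl fun i _ => lintegral_finsetSum' _ fun j _ => hm' i j
    _ < ⊤ := ENNReal.sum_lt_top.2 fun i _ => ENNReal.sum_lt_top.2 fun j _ => hint i j

theorem NLFPKIntegrable.intervalIntegrable_integral_Lop {T : ℝ} (hT : 0 ≤ T) {μ : ℝ → SP d}
    (hab : GoodCoeffs d a b) (hcont : ContinuousOn μ (Set.Icc 0 T))
    (hint : NLFPKIntegrable d T a b μ) {φ : Rd d → ℝ} (hφ : IsC2c φ) :
    IntervalIntegrable (fun s => ∫ x, Lop a b s (μ s) φ x ∂(μ s).1) volume 0 T := by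
  have hμ : AEMeasurable μ (volume.restrict (Set.Ioc 0 T)) :=
    (hcont.mono Set.Ioc_subset_Icc_self).aemeasurable measurableSet_Ioc
  obtain ⟨C, hC, h₁, h₂⟩ := hφ.exists_bound
  rw [intervalIntegrable_iff_integrableOn_Ioc_of_le hT]
  refine ⟨SP.aestronglyMeasurable_integral hμ (hab.measurable_Lop φ), ?_⟩
  rw [HasFiniteIntegral]
  calc _ ≤ ∫⁻ t in Set.Ioc (0 : ℝ) T, ENNReal.ofReal C * ∫⁻ x, ENNReal.ofReal
        ((∑ i, |b t (μ t) x i|) + ∑ i, ∑ j, |a t (μ t) x i j|) ∂(μ t).1 := by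
        refine lintegral_mono fun t => (enorm_integral_le_lintegral_enorm _).trans ?_
        rw [← lintegral_const_mul' _ _ ENNReal.ofReal_ne_top]
        refine lintegral_mono fun x => ?_
        rw [← ENNReal.ofReal_mul hC, Real.enorm_eq_ofReal_abs]
        exact ENNReal.ofReal_le_ofReal (abs_Lop_le h₁ h₂ t (μ t) x)
    _ < ⊤ := by
        rw [lintegral_const_mul' _ _ ENNReal.ofReal_ne_top]
        exact ENNReal.mul_lt_top ENNReal.ofReal_lt_top (hint.lintegral_sum_lt_top hab hcont)

end Coefficients

/-- any subprobability solution `(μ_t)` to (NLFPK) induces, via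
`Γ_t := δ_{μ_t}`, a weakly continuous solution to the linearized continuity
equation (SP-CE). -/
theorem dirac_curve_solves_SPCE (d : ℕ) (T : ℝ) (hT : 0 < T)
    (a : ℝ → SP d → Rd d → Fin d → Fin d → ℝ) (b : ℝ → SP d → Rd d → Fin d → ℝ)
    (hab : GoodCoeffs d a b) (g : ℕ → Rd d → ℝ) (hg : GFamily d g)
    (μ : ℝ → SP d) (hμ : IsSubprobSolution d T a b μ) :
    IsSPCESolution d T a b g (fun t => Measure.dirac (μ t)) := by
  obtain ⟨hcont, hint, heq⟩ := hμ
  refine ⟨fun t _ => inferInstance, fun F hF _ => ?_, ?_, fun n f hf t ht => ?_⟩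
  · simp_rw [integral_dirac]
    exact hF.comp_continuousOn hcont
  · simp_rw [lintegral_dirac]
    exact hint.lintegral_sum_lt_top hab hcont
  · simp_rw [integral_dirac]
    set H : ℝ → Fin n → ℝ := fun s k => ∫ x, Lop a b s (μ s) (g k) x ∂(μ s).1 with hH
    set u : ℝ → Fin n → ℝ := fun s k => ∫ x, g k x ∂(μ s).1 with hu
    have hHk : ∀ s ∈ Set.Icc 0 T, ∀ k, IntervalIntegrable (fun r => H r k) volume 0 s :=
      fun s hs k => (hint.intervalIntegrable_integral_Lop hT.le hab hcont (hg.1 k)).mono_set <| by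
        rw [Set.uIcc_of_le hs.1, Set.uIcc_of_le hT.le]
        exact Set.Icc_subset_Icc_right hs.2
    have hHi : ∀ s ∈ Set.Icc 0 T, IntervalIntegrable H volume 0 s := fun s hs =>
      ⟨Integrable.of_eval fun k => (hHk s hs k).1, Integrable.of_eval fun k => (hHk s hs k).2⟩
    have hus : ∀ s ∈ Set.Icc 0 T, u 0 + ∫ r in (0 : ℝ)..s, H r = u s := fun s hs => by
      funext k
      have := heq (g k) (hg.1 k) s hs
      rw [NLFPKEq] at this
      rw [Pi.add_apply, intervalIntegral_apply (hHi s hs) k, ← this]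
      simp [hu]
    have hchain := (hf.1.of_le one_le_two).integral_fderiv_comp_primitive (hHi t ht) (u 0)
    rw [hus t ht] at hchain
    refine hchain.trans (intervalIntegral.integral_congr fun s hs => ?_)
    rw [Set.uIcc_of_le ht.1] at hs
    simp only [hus s ⟨hs.1, hs.2.trans ht.2⟩, fderiv_apply_eq_sum_pd]
    rfl
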